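/- A measure space (Ω, 𝒜, μ) is weakly localisable if and only if the measure space (Ω, 𝒜_loc, μ_loc) is localisable. -/

import Mathlib

open MeasureTheory Set ENNReal

/-- A set `B` is locally measurable if `B ∩ A` is measurable for every measurable set `A`
of finite measure. -/
def LocallyMeasurable {Ω : Type*} [MeasurableSpace Ω] (μ : Measure Ω) (B : Set Ω) : Prop :=
  ∀ A : Set Ω, MeasurableSet A → μ A < ∞ → MeasurableSet (B ∩ A)

/-- The σ-algebra `𝒜_loc` of locally measurable sets. -/
def locSpace {Ω : Type*} [MeasurableSpace Ω] (μ : Measure Ω) : MeasurableSpace Ω where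
  MeasurableSet' := LocallyMeasurable μ
  measurableSet_empty := fun A hA _ => by
    rw [Set.empty_inter]; exact MeasurableSet.empty
  measurableSet_compl := fun B hB A hA hAfin => by
    have h : Bᶜ ∩ A = A \ (B ∩ A) := by ext x; by_cases hx : x ∈ B <;> simp [hx]
    rw [h]; exact hA.diff (hB A hA hAfin)
  measurableSet_iUnion := fun s hs A hA hAfin => by
    rw [Set.iUnion_inter]
    exact MeasurableSet.iUnion fun n => hs n A hA hAfin

/-- `μ_loc B = sup { μ (B ∩ A) : A measurable, μ A < ∞ }`. -/
noncomputable def muLoc {Ω : Type*} [MeasurableSpace Ω] (μ : Measure Ω) (B : Set Ω) : ℝ≥0∞ :=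
  ⨆ (A : Set Ω) (_ : MeasurableSet A ∧ μ A < ∞), μ (B ∩ A)

/-- Localisability of a measure `ν` on an explicit σ-algebra `m`: semi-finiteness plus
existence of essential suprema for arbitrary families of `m`-measurable sets. -/
def LocalisableOn {Ω : Type*} (m : MeasurableSpace Ω) (ν : @Measure Ω m) : Prop :=
  (∀ B : Set Ω, MeasurableSet[m] B → ν B = ∞ →
    ∃ A : Set Ω, MeasurableSet[m] A ∧ A ⊆ B ∧ 0 < ν A ∧ ν A < ∞) ∧
  ∀ E : Set (Set Ω), (∀ B ∈ E, MeasurableSet[m] B) →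
    ∃ S : Set Ω, MeasurableSet[m] S ∧ (∀ B ∈ E, ν (B \ S) = 0) ∧
      ∀ C : Set Ω, MeasurableSet[m] C → (∀ B ∈ E, ν (B \ C) = 0) → ν (S \ C) = 0

/-- A measure space is weakly localisable if every consistent family of measurable
functions `f_A : A → ℝ`, indexed by the measurable sets `A` of finite measure, is
realised `μ`-a.e. on each `A` by a single locally measurable function. -/
def WeaklyLocalisable {Ω : Type*} [MeasurableSpace Ω] (μ : Measure Ω) : Prop :=
  ∀ f : Set Ω → Ω → ℝ,
    (∀ A : Set Ω, MeasurableSet A → μ A < ∞ → Measurable (A.indicator (f A))) →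
    (∀ A B : Set Ω, MeasurableSet A → μ A < ∞ → MeasurableSet B → μ B < ∞ →
      ∀ᵐ x ∂(μ.restrict (A ∩ B)), f A x = f B x) →
    ∃ g : Ω → ℝ, (∀ A : Set Ω, MeasurableSet A → μ A < ∞ → Measurable (A.indicator g)) ∧
      ∀ A : Set Ω, MeasurableSet A → μ A < ∞ → ∀ᵐ x ∂(μ.restrict A), g x = f A x

/-- In a finite measure space, a family of null measurable sets is almost everywhere exhausted
by a countable subfamily. -/
theorem exists_countable_subset_measure_diff_sUnion_eq_zero {Ω : Type*} [MeasurableSpace Ω]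
    (μ : Measure Ω) [IsFiniteMeasure μ] (E : Set (Set Ω))
    (hE : ∀ B ∈ E, NullMeasurableSet B μ) :
    ∃ D ⊆ E, D.Countable ∧ ∀ B ∈ E, μ (B \ ⋃₀ D) = 0 := by
  let T : Set ℝ≥0∞ := {t | ∃ D ⊆ E, D.Countable ∧ μ (⋃₀ D) = t}
  have hT : T.Nonempty := ⟨_, ∅, empty_subset _, countable_empty, rfl⟩
  obtain ⟨u, -, hu, huT⟩ := exists_seq_tendsto_sSup hT (OrderTop.bddAbove T)
  choose D hDE hDc hDu using huT
  have hE' : (⋃ n, D n) ⊆ E := iUnion_subset hDE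
  have hc : (⋃ n, D n).Countable := countable_iUnion hDc
  refine ⟨⋃ n, D n, hE', hc, fun B hB => ?_⟩
  have hge : sSup T ≤ μ (⋃₀ ⋃ n, D n) :=
    le_of_tendsto' hu fun n => (hDu n).symm.trans_le
      (measure_mono (sUnion_subset_sUnion (subset_iUnion D n)))
  have hle : μ (⋃₀ insert B (⋃ n, D n)) ≤ sSup T :=
    le_sSup ⟨_, insert_subset hB hE', hc.insert B, rfl⟩
  have hnull : NullMeasurableSet (⋃₀ ⋃ n, D n) μ :=
    NullMeasurableSet.sUnion hc fun s hs => hE s (hE' hs)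
  have hdiff : B \ ⋃₀ (⋃ n, D n) = ⋃₀ insert B (⋃ n, D n) \ ⋃₀ (⋃ n, D n) := by
    rw [sUnion_insert, union_sdiff_right]
  rw [hdiff, measure_sdiff (sUnion_subset_sUnion (subset_insert _ _)) hnull (measure_ne_top _ _)]
  exact tsub_eq_zero_of_le (hle.trans hge)

section LocallyMeasurable

variable {Ω : Type*} [MeasurableSpace Ω] {μ : Measure Ω}

theorem MeasurableSet.locallyMeasurable {B : Set Ω} (hB : MeasurableSet B) :
    LocallyMeasurable μ B := fun _ hA _ => hB.inter hA

theorem muLoc_eq_zero_iff {B : Set Ω} :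
    muLoc μ B = 0 ↔ ∀ A, MeasurableSet A → μ A < ∞ → μ (B ∩ A) = 0 := by
  simp [muLoc]

theorem muLoc_of_measure_lt_top {B : Set Ω} (hB : MeasurableSet B) (hfin : μ B < ∞) :
    muLoc μ B = μ B := by
  apply le_antisymm
  · exact iSup₂_le fun A _ => measure_mono inter_subset_left
  · exact le_iSup₂_of_le B ⟨hB, hfin⟩ (by rw [inter_self])

theorem LocallyMeasurable.nullMeasurableSet_restrict {A B : Set Ω} (hB : LocallyMeasurable μ B)
    (hA : MeasurableSet A) (hfin : μ A < ∞) : NullMeasurableSet B (μ.restrict A) := by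
  refine (hB A hA hfin).nullMeasurableSet.congr ?_
  filter_upwards [ae_restrict_mem hA] with x hx
  exact propext (and_iff_left hx)

theorem LocallyMeasurable.diff {B C : Set Ω} (hB : LocallyMeasurable μ B)
    (hC : LocallyMeasurable μ C) : LocallyMeasurable μ (B \ C) :=
  MeasurableSet.diff (m := locSpace μ) hB hC

theorem measurable_locSpace_iff {g : Ω → ℝ} :
    Measurable[locSpace μ] g ↔
      ∀ A, MeasurableSet A → μ A < ∞ → Measurable (A.indicator g) := by
  constructor
  · intro hg A hA hfin s hs
    rw [indicator_preimage]
    exact (hg hs A hA hfin).union ((measurable_const hs).diff hA)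
  · intro hg s hs A hA hfin
    have h : g ⁻¹' s ∩ A = A.indicator g ⁻¹' s ∩ A := by
      ext x
      by_cases hx : x ∈ A <;> simp [hx]
    rw [h]
    exact (hg A hA hfin hs).inter hA

theorem exists_subset_measure_pos_lt_top_of_eq_muLoc (ν : @Measure Ω (locSpace μ))
    (hν : ∀ B, LocallyMeasurable μ B → ν B = muLoc μ B) {B : Set Ω}
    (hB : LocallyMeasurable μ B) (hpos : ν B ≠ 0) :
    ∃ A, MeasurableSet[locSpace μ] A ∧ A ⊆ B ∧ 0 < ν A ∧ ν A < ∞ := by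
  rw [hν B hB, Ne, muLoc_eq_zero_iff] at hpos
  push Not at hpos
  obtain ⟨A, hA, hfin, hne⟩ := hpos
  have hm : MeasurableSet (B ∩ A) := hB A hA hfin
  have hlt : μ (B ∩ A) < ∞ := (measure_mono inter_subset_right).trans_lt hfin
  have hl : LocallyMeasurable μ (B ∩ A) := hm.locallyMeasurable
  have heq : ν (B ∩ A) = μ (B ∩ A) := (hν _ hl).trans (muLoc_of_measure_lt_top hm hlt)
  exact ⟨B ∩ A, hl, inter_subset_left, heq ▸ pos_iff_ne_zero.2 hne, heq ▸ hlt⟩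

theorem WeaklyLocalisable.exists_essSup (h : WeaklyLocalisable μ) (E : Set (Set Ω))
    (hE : ∀ B ∈ E, LocallyMeasurable μ B) :
    ∃ S, LocallyMeasurable μ S ∧ (∀ B ∈ E, muLoc μ (B \ S) = 0) ∧
      ∀ C, (∀ B ∈ E, muLoc μ (B \ C) = 0) → muLoc μ (S \ C) = 0 := by
  have key : ∀ A : Set Ω, ∃ D ⊆ E, D.Countable ∧
      (MeasurableSet A → μ A < ∞ → ∀ B ∈ E, μ.restrict A (B \ ⋃₀ D) = 0) := by
    intro A
    by_cases hA : MeasurableSet A ∧ μ A < ∞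
    · have : IsFiniteMeasure (μ.restrict A) := ⟨by simpa using hA.2⟩
      obtain ⟨D, hDE, hDc, hD⟩ := exists_countable_subset_measure_diff_sUnion_eq_zero
        (μ.restrict A) E fun B hB => (hE B hB).nullMeasurableSet_restrict hA.1 hA.2
      exact ⟨D, hDE, hDc, fun _ _ => hD⟩
    · exact ⟨∅, empty_subset _, countable_empty, fun h₁ h₂ => (hA ⟨h₁, h₂⟩).elim⟩
  choose D hDE hDc hD using key
  have hloc : ∀ A, MeasurableSet[locSpace μ] (⋃₀ D A) := fun A =>
    MeasurableSet.sUnion (m := locSpace μ) (hDc A) fun B hB => hE B (hDE A hB)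
  have hsub : ∀ A C, (∀ B ∈ E, μ.restrict A (B \ C) = 0) →
      ∀ A', ∀ᵐ x ∂μ.restrict A, x ∈ ⋃₀ D A' → x ∈ C := by
    intro A C hC A'
    have hall : ∀ᵐ x ∂μ.restrict A, ∀ B ∈ D A', x ∈ B → x ∈ C := by
      rw [ae_ball_iff (hDc A')]
      intro B hB
      exact ae_le_set.2 (hC B (hDE A' hB))
    filter_upwards [hall] with x hx
    rintro ⟨B, hB, hxB⟩
    exact hx B hB hxB
  obtain ⟨g, hg, hgf⟩ := h (fun A => (⋃₀ D A).indicator 1)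
    (by
      intro A hA hfin
      rw [indicator_indicator, inter_comm]
      exact measurable_one.indicator (hloc A A hA hfin))
    (by
      intro A A' hA hAfin hA' hA'fin
      filter_upwards [ae_restrict_of_ae_restrict_of_subset inter_subset_left
          (hsub A _ (hD A hA hAfin) A'),
        ae_restrict_of_ae_restrict_of_subset inter_subset_right
          (hsub A' _ (hD A' hA' hA'fin) A)] with x h₁ h₂
      by_cases hx : x ∈ ⋃₀ D A
      · simp only [indicator_of_mem hx, indicator_of_mem (h₂ hx)]
      · simp only [indicator_of_notMem hx, indicator_of_notMem fun hx' => hx (h₁ hx')])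
  have hgm : Measurable[locSpace μ] g := measurable_locSpace_iff.2 hg
  have hS : ∀ A, MeasurableSet A → μ A < ∞ →
      ∀ᵐ x ∂μ.restrict A, x ∈ g ⁻¹' {1} ↔ x ∈ ⋃₀ D A := by
    intro A hA hfin
    filter_upwards [hgf A hA hfin] with x hx
    rw [mem_preimage, hx, mem_singleton_iff]
    by_cases hxD : x ∈ ⋃₀ D A
    · simp only [indicator_of_mem hxD, hxD, Pi.one_apply]
    · simp only [indicator_of_notMem hxD, hxD, zero_ne_one]
  refine ⟨g ⁻¹' {1}, hgm (measurableSet_singleton 1), fun B hB => ?_, fun C hC => ?_⟩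
  · rw [muLoc_eq_zero_iff]
    intro A hA hfin
    rw [← Measure.restrict_apply' hA]
    refine ae_le_set.1 ?_
    filter_upwards [hS A hA hfin, ae_le_set.2 (hD A hA hfin B hB)] with x hx hxB hxm
    exact hx.2 (hxB hxm)
  · rw [muLoc_eq_zero_iff]
    intro A hA hfin
    rw [← Measure.restrict_apply' hA]
    refine ae_le_set.1 ?_
    have hCA : ∀ B ∈ E, μ.restrict A (B \ C) = 0 := fun B hB => by
      rw [Measure.restrict_apply' hA]
      exact muLoc_eq_zero_iff.1 (hC B hB) A hA hfin
    filter_upwards [hS A hA hfin, hsub A C hCA A] with x hx hxC hxm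
    exact hxC (hx.1 hxm)

theorem EReal.iSup_rat_ite_lt (y : ℝ) :
    ⨆ q : ℚ, (if (q : ℝ) < y then ((q : ℝ) : EReal) else ⊥) = y := by
  apply le_antisymm
  · refine iSup_le fun q => ?_
    split_ifs with hq
    · exact EReal.coe_le_coe_iff.2 hq.le
    · exact bot_le
  · refine le_of_forall_lt fun c hc => ?_
    obtain ⟨q, hcq, hqy⟩ := EReal.lt_iff_exists_rat_btwn.1 hc
    refine hcq.trans_le (le_iSup_of_le q ?_)
    rw [if_pos (EReal.coe_lt_coe_iff.1 hqy)]

/-- A consistent family of measurable functions is glued from the essential suprema of the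
superlevel sets at rational heights. -/
theorem weaklyLocalisable_of_exists_essSup
    (h : ∀ E : Set (Set Ω), (∀ B ∈ E, LocallyMeasurable μ B) →
      ∃ S, LocallyMeasurable μ S ∧ (∀ B ∈ E, muLoc μ (B \ S) = 0) ∧
        ∀ C, LocallyMeasurable μ C → (∀ B ∈ E, muLoc μ (B \ C) = 0) → muLoc μ (S \ C) = 0) :
    WeaklyLocalisable μ := by
  intro f hf hcons
  have hlev : ∀ (q : ℚ) (A : Set Ω), MeasurableSet A → μ A < ∞ →
      MeasurableSet (A ∩ {x | (q : ℝ) < f A x}) := by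
    intro q A hA hfin
    have heq : A ∩ {x | (q : ℝ) < f A x} = A ∩ {x | (q : ℝ) < A.indicator (f A) x} := by
      ext x
      by_cases hx : x ∈ A <;> simp [hx]
    rw [heq]
    exact hA.inter (measurableSet_lt measurable_const (hf A hA hfin))
  have key : ∀ q : ℚ, ∃ S, LocallyMeasurable μ S ∧ ∀ A, MeasurableSet A → μ A < ∞ →
      ∀ᵐ x ∂μ.restrict A, x ∈ S ↔ (q : ℝ) < f A x := by
    intro q
    obtain ⟨S, hS, hub, hleast⟩ := h
      {B | ∃ A, MeasurableSet A ∧ μ A < ∞ ∧ A ∩ {x | (q : ℝ) < f A x} = B} (by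
        rintro _ ⟨A, hA, hfin, rfl⟩
        exact (hlev q A hA hfin).locallyMeasurable)
    refine ⟨S, hS, fun A hA hfin => ?_⟩
    have h₁ := muLoc_eq_zero_iff.1 (hub _ ⟨A, hA, hfin, rfl⟩) A hA hfin
    have h₂ := muLoc_eq_zero_iff.1 (hleast (A \ (A ∩ {x | (q : ℝ) < f A x}))ᶜ
      (hA.diff (hlev q A hA hfin)).compl.locallyMeasurable (by
        rintro _ ⟨A', hA', hfin', rfl⟩
        have hnull : μ.restrict (A ∩ A') {x | ¬ f A x = f A' x} = 0 :=
          hcons A A' hA hfin hA' hfin'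
        rw [Measure.restrict_apply' (hA.inter hA')] at hnull
        rw [muLoc_eq_zero_iff]
        refine fun K _ _ => measure_mono_null ?_ hnull
        rintro x ⟨⟨⟨hxA', hx'⟩, hx⟩, -⟩
        rw [mem_compl_iff, not_not] at hx
        refine ⟨fun heq => hx.2 ⟨hx.1, ?_⟩, hx.1, hxA'⟩
        rw [mem_ofPred_eq, heq]
        exact hx')) A hA hfin
    rw [← Measure.restrict_apply' hA] at h₁ h₂
    filter_upwards [ae_le_set.2 h₁, ae_le_set.2 h₂, ae_restrict_mem hA] with x hx₁ hx₂ hxA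
    refine ⟨fun hxS => ?_, fun hx => hx₁ ⟨hxA, hx⟩⟩
    by_contra hx
    exact hx₂ hxS ⟨hxA, fun hx' => hx hx'.2⟩
  choose S hS hSf using key
  classical
  let G : Ω → EReal := fun x => ⨆ q : ℚ, if x ∈ S q then ((q : ℝ) : EReal) else ⊥
  have hG : Measurable[locSpace μ] G :=
    Measurable.iSup fun q =>
      Measurable.ite (p := (· ∈ S q)) (hS q :)
        (@measurable_const _ _ _ (locSpace μ) _) (@measurable_const _ _ _ (locSpace μ) _)
  refine ⟨fun x => (G x).toReal, measurable_locSpace_iff.1 hG.ereal_toReal,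
    fun A hA hfin => ?_⟩
  have hall : ∀ᵐ x ∂μ.restrict A, ∀ q : ℚ, x ∈ S q ↔ (q : ℝ) < f A x :=
    ae_all_iff.2 fun q => hSf q A hA hfin
  filter_upwards [hall] with x hx
  have hGx : G x = f A x := by
    simp only [G, hx]
    exact EReal.iSup_rat_ite_lt (f A x)
  rw [hGx, EReal.toReal_coe]

end LocallyMeasurable

/-- `(Ω, 𝒜, μ)` is weakly localisable iff `(Ω, 𝒜_loc, μ_loc)` is localisable.
Here `ν` is the measure on `𝒜_loc` induced by `μ_loc`. -/
theorem weaklyLocalisable_iff_locSpace_localisable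
    {Ω : Type*} [MeasurableSpace Ω] (μ : Measure Ω)
    (ν : @Measure Ω (locSpace μ)) (hν : ∀ B : Set Ω, LocallyMeasurable μ B → ν B = muLoc μ B) :
    WeaklyLocalisable μ ↔ LocalisableOn (locSpace μ) ν := by
  have hdiff : ∀ {B C : Set Ω}, LocallyMeasurable μ B → LocallyMeasurable μ C →
      ν (B \ C) = muLoc μ (B \ C) := fun hB hC => hν _ (hB.diff hC)
  constructor
  · refine fun h => ⟨fun B hB htop => ?_, fun E hE => ?_⟩
    · exact exists_subset_measure_pos_lt_top_of_eq_muLoc ν hν hB (htop ▸ top_ne_zero)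
    · obtain ⟨S, hS, hub, hleast⟩ := h.exists_essSup E hE
      refine ⟨S, hS, fun B hB => (hdiff (hE B hB) hS).trans (hub B hB), fun C hC hCE => ?_⟩
      exact (hdiff hS hC).trans
        (hleast C fun B hB => (hdiff (hE B hB) hC).symm.trans (hCE B hB))
  · refine fun h => weaklyLocalisable_of_exists_essSup fun E hE => ?_
    obtain ⟨S, hS, hub, hleast⟩ := h.2 E hE
    refine ⟨S, hS, fun B hB => (hdiff (hE B hB) hS).symm.trans (hub B hB), fun C hC hCE => ?_⟩
    exact (hdiff hS hC).symm.trans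
      (hleast C hC fun B hB => (hdiff (hE B hB) hC).trans (hCE B hB))
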